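/- Let B be a standard Brownian motion. Then P{ there exists T < ∞ such that B(t)² ≤ 2t( log log t + (3/2) log log log t ) for all t ≥ T } = 0; equivalently, almost surely there exist arbitrarily large t with B(t)² > 2t( log log t + (3/2) log log log t ). Consequently, for every H > 0, almost surely limsup_{t→∞} t^{H−γ} exp( exp( B(t)² / (2t) ) ) = ∞ for every γ ∈ ℝ; in particular, for the H-self-similar process X(t) = t^H exp(exp(B(t)²/(2t))) (t > 0), the storage process Y(t) = sup_{s ≥ t}( X(s) − X(t) − c (s − t)^γ ) is almost surely infinite for every t ≥ 0, every c > 0 and every γ ∈ ℝ. -/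

import Mathlib

open MeasureTheory Filter Set ProbabilityTheory

noncomputable section

namespace BSI
open scoped NNReal ENNReal

/-- Restriction of the process to nonnegative times is pre-Brownian. -/
lemma preBrownian {Ω : Type*} [MeasurableSpace Ω] (P : Measure Ω) [IsProbabilityMeasure P]
    (B : ℝ → Ω → ℝ)
    (hmeas : ∀ t : ℝ, Measurable (B t))
    (hB0 : ∀ᵐ ω ∂P, B 0 ω = 0)
    (hgauss : ∀ s t : ℝ, 0 ≤ s → s ≤ t →
      Measure.map (fun ω => B t ω - B s ω) P = gaussianReal 0 (Real.toNNReal (t - s)))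
    (hindep : ∀ n : ℕ, ∀ ts : Fin (n + 1) → ℝ, Monotone ts → 0 ≤ ts 0 →
      iIndepFun (m := fun _ : Fin n => (inferInstance : MeasurableSpace ℝ))
        (fun i ω => B (ts i.succ) ω - B (ts i.castSucc) ω) P) :
    IsPreBrownianReal (fun t : ℝ≥0 => B (t : ℝ)) P := by
  apply HasIndepIncrements.isPreBrownianReal_of_hasLaw
  · intro t
    refine ⟨(hmeas _).aemeasurable, ?_⟩
    have h := hgauss 0 t le_rfl t.2
    have h2 : Measure.map (B t) P = Measure.map (fun ω => B t ω - B 0 ω) P := by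
      apply Measure.map_congr
      filter_upwards [hB0] with ω hω
      simp [hω]
    rw [h2, h]
    simp
  · intro n ts hts
    exact hindep n (fun i => (ts i : ℝ)) (fun i j hij => by exact_mod_cast hts hij) (ts 0).2

lemma blocks_indep {Ω : Type*} [MeasurableSpace Ω] (P : Measure Ω) [IsProbabilityMeasure P]
    (W : ℝ≥0 → Ω → ℝ) (hW : IsPreBrownianReal W P)
    (a : ℕ → ℝ≥0) (ha : Monotone a) (N : ℕ → ℕ) (b : (i : ℕ) → Fin (N i) → ℝ≥0)
    (h1 : ∀ i l, a i ≤ b i l) (h2 : ∀ i l, b i l ≤ a (i+1)) :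
    iIndepFun (fun i ω (l : Fin (N i)) => W (b i l) ω - W (a i) ω) P := by
  classical
  refine IsGaussianProcess.iIndepFun_of_covariance_eq_zero
    (X := fun i l ω => W (b i l) ω - W (a i) ω) ?_ ?_ ?_
  · refine hW.isGaussianProcess.of_isGaussianProcess fun p => ⟨{a p.1, b p.1 p.2},
      { toFun x := x ⟨b p.1 p.2, by simp⟩ - x ⟨a p.1, by simp⟩
        map_add' x y := by simp; abel
        map_smul' c x := by simp; ring }, ?_⟩
    intro ω; simp
  · intro t s
    exact (hW.aemeasurable _).sub (hW.aemeasurable _)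
  · intro i j hij l m
    rw [covariance_fun_sub_fun_sub]
    · simp_rw [hW.covariance_fun_eval]
      rcases lt_or_gt_of_ne hij with h | h
      · have h3 : a (i+1) ≤ a j := ha h
        have e1 := h1 i l
        have e2 := h2 i l
        have e3 := h1 j m
        have := ((e2.trans h3).trans e3)
        rw [min_eq_left this, min_eq_left (e2.trans h3), min_eq_left (e1.trans this),
          min_eq_left (e1.trans (e2.trans h3))]
        simp
      · have h3 : a (j+1) ≤ a i := ha h
        have e1 := h1 j m
        have e2 := h2 j m
        have e3 := h1 i l
        have := ((e2.trans h3).trans e3)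
        rw [min_eq_right this, min_eq_right (e2.trans h3), min_eq_right (e1.trans this),
          min_eq_right (e1.trans (e2.trans h3))]
        simp
    all_goals exact (hW.isGaussianProcess.hasGaussianLaw_eval _).memLp_two

/-- Gaussian upper tail. -/
lemma gauss_tail {Ω : Type*} [MeasurableSpace Ω] (P : Measure Ω) [IsProbabilityMeasure P]
    (X : Ω → ℝ) (hX : Measurable X) (v : ℝ≥0) (h : Measure.map X P = gaussianReal 0 v)
    (ε : ℝ) (hε : 0 ≤ ε) : P.real {ω | ε ≤ X ω} ≤ Real.exp (-ε ^ 2 / (2 * v)) := by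
  refine HasSubgaussianMGF.measure_ge_le (X := X) (c := v) (μ := P) ⟨?_, ?_⟩ hε
  · intro t
    have := integrable_exp_mul_gaussianReal (μ := 0) (v := v) t
    rw [← h] at this
    exact this.comp_measurable hX
  · intro t
    rw [mgf_gaussianReal h]
    simp

/-- Gaussian window lower bound. -/
lemma gauss_window {Ω : Type*} [MeasurableSpace Ω] (P : Measure Ω) [IsProbabilityMeasure P]
    (X : Ω → ℝ) (hX : Measurable X) (v : ℝ) (hv : 0 < v)
    (h : Measure.map X P = gaussianReal 0 v.toNNReal)
    (ψ : ℝ) (hψ : 1 ≤ ψ) :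
    Real.exp (-3/2) / Real.sqrt (2 * Real.pi) * Real.exp (-ψ^2/2) / ψ ≤
      P.real {ω | ψ * √v < X ω ∧ X ω ≤ (ψ + 1/ψ) * √v} := by
  have hψ0 : 0 < ψ := by linarith
  have hsv : 0 < √v := Real.sqrt_pos.2 hv
  have hv' : v.toNNReal ≠ 0 := by simpa using hv
  have hset : {ω | ψ * √v < X ω ∧ X ω ≤ (ψ + 1/ψ) * √v} =
      X ⁻¹' (Ioc (ψ * √v) ((ψ + 1/ψ) * √v)) := rfl
  rw [hset, measureReal_def, ← Measure.map_apply hX measurableSet_Ioc, h,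
    gaussianReal_apply_eq_integral _ hv', ENNReal.toReal_ofReal]
  swap
  · exact integral_nonneg (fun x => gaussianPDFReal_nonneg _ _ _)
  set c := Real.exp (-3/2) / Real.sqrt (2 * Real.pi) * Real.exp (-ψ^2/2) / √v with hc
  have hint : ∫ x in Ioc (ψ * √v) ((ψ + 1/ψ) * √v), c = c * (√v/ψ) := by
    rw [setIntegral_const, measureReal_def, Real.volume_Ioc, ENNReal.toReal_ofReal]
    · simp only [smul_eq_mul]; ring
    · have : 0 ≤ 1/ψ * √v := by positivity
      nlinarith
  have : Real.exp (-3/2) / Real.sqrt (2 * Real.pi) * Real.exp (-ψ^2/2) / ψ = c * (√v/ψ) := by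
    rw [hc]; field_simp
  rw [this, ← hint]
  apply setIntegral_mono_on
  · exact integrableOn_const (by simp)
  · exact (integrable_gaussianPDFReal _ _).integrableOn
  · exact measurableSet_Ioc
  · intro x hx
    rw [gaussianPDFReal_def, Real.coe_toNNReal _ hv.le, hc]
    simp only [sub_zero]
    have e1 : √(2 * Real.pi * v) = √(2 * Real.pi) * √v := Real.sqrt_mul (by positivity) _
    rw [e1]
    have hx0 : 0 ≤ x := le_trans (by positivity) hx.1.le
    have e2 : x^2 ≤ (ψ^2 + 3) * v := by
      have : x^2 ≤ ((ψ + 1/ψ) * √v)^2 := by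
        apply pow_le_pow_left₀ hx0 hx.2
      rw [mul_pow, Real.sq_sqrt hv.le] at this
      refine this.trans ?_
      apply mul_le_mul_of_nonneg_right _ hv.le
      have e4 : 1/ψ ≤ 1 := by rw [div_le_one hψ0]; exact hψ
      have e5 : 0 ≤ 1/ψ := by positivity
      have e6 : ψ * (1/ψ) = 1 := by field_simp
      nlinarith
    have e3 : -3/2 + -ψ^2/2 ≤ -x^2/(2*v) := by
      rw [le_div_iff₀ (by positivity)]
      nlinarith
    calc Real.exp (-3/2) / Real.sqrt (2 * Real.pi) * Real.exp (-ψ^2/2) / √v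
        = (√(2 * Real.pi) * √v)⁻¹ * Real.exp (-3/2 + -ψ^2/2) := by
          rw [Real.exp_add]; field_simp
      _ ≤ _ := by
          apply mul_le_mul_of_nonneg_left _ (by positivity)
          exact Real.exp_le_exp.2 e3

/-- Bonferroni. -/
lemma bonferroni {Ω : Type*} [MeasurableSpace Ω] (P : Measure Ω) [IsProbabilityMeasure P]
    (N : ℕ) (A : ℕ → Set Ω) (hA : ∀ l, MeasurableSet (A l)) (p : ℝ)
    (hp : ∀ l < N, p ≤ P.real (A l)) (g : ℕ → ℝ) (hg0 : ∀ d, 0 ≤ g d)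
    (hg : ∀ l d, P.real (A l ∩ A (l + (d+1))) ≤ P.real (A l) * g d)
    (hs : ∑ d ∈ Finset.range N, g d ≤ 1/2) :
    N * p / 2 ≤ P.real (⋃ l ∈ Finset.range N, A l) := by
  have key : ∀ n ≤ N, ∑ l ∈ Finset.Ico (N-n) N, P.real (A l) * (1 - ∑ d ∈ Finset.range (N-1-l), g d)
      ≤ P.real (⋃ l ∈ Finset.Ico (N-n) N, A l) := by
    intro n
    induction n with
    | zero => intro _; simp
    | succ n ih =>
      intro hn
      have ih := ih (by omega)
      set k := N - (n+1) with hk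
      have hk1 : N - n = k + 1 := by omega
      have hkN : k < N := by omega
      rw [hk1] at ih
      rw [Finset.sum_eq_sum_Ico_succ_bot hkN]
      set U := ⋃ l ∈ Finset.Ico (k+1) N, A l with hU
      have hUm : MeasurableSet U := Finset.measurableSet_biUnion _ (fun l _ => hA l)
      have hun : (⋃ l ∈ Finset.Ico k N, A l) = A k ∪ U := by
        ext ω
        simp only [hU, mem_iUnion, mem_union, Finset.mem_Ico, exists_prop]
        constructor
        · rintro ⟨l, ⟨h1, h2⟩, h3⟩
          rcases h1.eq_or_lt with rfl | h
          · exact Or.inl h3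
          · exact Or.inr ⟨l, ⟨h, h2⟩, h3⟩
        · rintro (h | ⟨l, ⟨h1, h2⟩, h3⟩)
          · exact ⟨k, ⟨le_rfl, hkN⟩, h⟩
          · exact ⟨l, ⟨by omega, h2⟩, h3⟩
      rw [hun]
      have h1 := measureReal_union_add_inter (μ := P) (s := A k) (t := U) hUm (measure_ne_top _ _)
        (measure_ne_top _ _)
      have h2 : P.real (A k ∩ U) ≤ P.real (A k) * ∑ d ∈ Finset.range (N-1-k), g d := by
        have : A k ∩ U ⊆ ⋃ d ∈ Finset.range (N-1-k), (A k ∩ A (k+(d+1))) := by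
          rintro ω ⟨ha, hb⟩
          simp only [hU, mem_iUnion, Finset.mem_Ico, exists_prop] at hb
          obtain ⟨l, ⟨h1, h2⟩, h3⟩ := hb
          simp only [mem_iUnion, Finset.mem_range, exists_prop]
          refine ⟨l - (k+1), by omega, ha, ?_⟩
          convert h3 using 2
          omega
        calc P.real (A k ∩ U) ≤ P.real (⋃ d ∈ Finset.range (N-1-k), (A k ∩ A (k+(d+1)))) :=
              measureReal_mono this (measure_ne_top _ _)
          _ ≤ ∑ d ∈ Finset.range (N-1-k), P.real (A k ∩ A (k+(d+1))) :=
              measureReal_biUnion_finset_le _ _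
          _ ≤ ∑ d ∈ Finset.range (N-1-k), P.real (A k) * g d :=
              Finset.sum_le_sum (fun d _ => hg k d)
          _ = _ := by rw [Finset.mul_sum]
      linarith
  have := key N le_rfl
  simp only [Nat.sub_self, ← Finset.range_eq_Ico] at this
  refine le_trans ?_ this
  calc (N:ℝ) * p / 2 = ∑ l ∈ Finset.range N, p * (1/2) := by simp; ring
    _ ≤ _ := by
      apply Finset.sum_le_sum
      intro l hl
      have h1 := hp l (Finset.mem_range.1 hl)
      have h2 : ∑ d ∈ Finset.range (N-1-l), g d ≤ 1/2 :=
        le_trans (Finset.sum_le_sum_of_subset_of_nonneg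
          (Finset.range_mono (by omega)) (fun d _ _ => hg0 d)) hs
      have h3 : (0:ℝ) ≤ P.real (A l) := measureReal_nonneg
      nlinarith

lemma g_bound (w : ℝ) (hw : 2 ≤ w) (d : ℕ) (hd : 1 ≤ d) (u : ℝ)
    (hu : u = Real.exp (192 / w * d / 2) - 1) :
    2 / w ≤ u ∧ Real.exp (-(w * (u - 1/w)^2) / (2 * (u * (u+2)))) ≤
      Real.exp (-4 * d) + (if (d:ℝ) ≤ w^2 then Real.exp (-w/24) else 0) + Real.exp (2 - w/2) := by
  have hw0 : 0 < w := by linarith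
  have hd1 : (1:ℝ) ≤ d := by exact_mod_cast hd
  have hu1 : 192 / w * d / 2 ≤ u := by
    rw [hu]; have := Real.add_one_le_exp (192 / w * d / 2); linarith
  have hu1' : 96 * d / w ≤ u := by
    refine le_trans (le_of_eq ?_) hu1
    field_simp; norm_num
  have hu1'' : 96 * d ≤ u * w := by rwa [div_le_iff₀ hw0] at hu1'
  have hu2 : 2 / w ≤ u := by
    rw [div_le_iff₀ hw0]; linarith
  refine ⟨hu2, ?_⟩
  have hu0 : 0 < u := lt_of_lt_of_le (by positivity) hu2
  have e1 : 0 < Real.exp (-4 * d) := Real.exp_pos _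
  have e2 : 0 ≤ (if (d:ℝ) ≤ w^2 then Real.exp (-w/24) else 0) := by split_ifs <;> positivity
  have e3 : 0 < Real.exp (2 - w/2) := Real.exp_pos _
  have h12 : u/2 ≤ u - 1/w := by
    have : 2/w = 2 * (1/w) := by ring
    linarith
  have hsq : u^2/4 ≤ (u-1/w)^2 := by nlinarith
  by_cases hb : w ≤ u + 1
  · -- far
    have : -(w * (u - 1/w)^2) / (2 * (u * (u+2))) ≤ 2 - w/2 := by
      rw [div_le_iff₀ (by positivity)]
      have h1 : 1/w ≤ 1 := by rw [div_le_one hw0]; linarith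
      have h2 : (u-1)^2 ≤ (u - 1/w)^2 := by
        apply pow_le_pow_left₀ (by linarith); linarith
      -- w (u-1)^2 >= (w - 4) u (u+2)
      have h3 : w * (u-1)^2 ≤ w * (u - 1/w)^2 := by nlinarith
      nlinarith [mul_nonneg hu0.le (sub_nonneg.2 hb)]
    have := Real.exp_le_exp.2 this
    linarith
  · push Not at hb
    have hdw : (d:ℝ) ≤ w^2 := by nlinarith
    rw [if_pos hdw]
    by_cases hu3 : u ≤ 1
    · have : -(w * (u - 1/w)^2) / (2 * (u * (u+2))) ≤ -4 * d := by
        rw [div_le_iff₀ (by positivity)]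
        have h3 : w * (u^2/4) ≤ w * (u - 1/w)^2 := by nlinarith
        have h4 : u * (96 * d) ≤ u * (u * w) := mul_le_mul_of_nonneg_left hu1'' hu0.le
        have h5 : u * d * (u+2) ≤ u * d * 3 := by
          apply mul_le_mul_of_nonneg_left _ (by positivity); linarith
        nlinarith
      have := Real.exp_le_exp.2 this
      have := Real.exp_pos (-w/24)
      linarith
    · push Not at hu3
      have : -(w * (u - 1/w)^2) / (2 * (u * (u+2))) ≤ -w/24 := by
        rw [div_le_iff₀ (by positivity)]
        have h3 : w * (u^2/4) ≤ w * (u - 1/w)^2 := by nlinarith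
        have h4 : w * (u * (u+2)) ≤ w * (u * (3 * u)) := by
          apply mul_le_mul_of_nonneg_left _ hw0.le
          apply mul_le_mul_of_nonneg_left _ hu0.le; linarith
        nlinarith
      have := Real.exp_le_exp.2 this
      linarith

lemma g_sum (w : ℝ) (hw : 2 ≤ w) (N : ℕ)
    (hN : w^2 * Real.exp (-w/24) + N * Real.exp (2 - w/2) ≤ 1/4) :
    ∑ d ∈ Finset.range N, (Real.exp (-4 * ((d+1 : ℕ):ℝ)) +
      (if ((d+1 : ℕ):ℝ) ≤ w^2 then Real.exp (-w/24) else 0) + Real.exp (2 - w/2)) ≤ 1/2 := by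
  rw [Finset.sum_add_distrib, Finset.sum_add_distrib]
  have h1 : ∑ d ∈ Finset.range N, Real.exp (-4 * ((d+1 : ℕ):ℝ)) ≤ 1/4 := by
    set q := Real.exp (-4) with hq
    have hq0 : 0 < q := Real.exp_pos _
    have hq1 : q ≤ 1/5 := by
      rw [hq, Real.exp_neg, one_div]
      apply inv_anti₀ (by norm_num)
      have := Real.add_one_le_exp (4:ℝ); linarith
    have : ∀ d : ℕ, Real.exp (-4 * ((d+1 : ℕ):ℝ)) = q * q^d := by
      intro d
      rw [hq, ← Real.exp_nat_mul, ← Real.exp_add]; congr 1; push_cast; ring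
    simp_rw [this]
    rw [← Finset.mul_sum, geom_sum_eq (by linarith)]
    have : (q^N - 1)/(q-1) = (1 - q^N)/(1-q) := by rw [← neg_div_neg_eq]; ring
    rw [this, ← mul_div_assoc, div_le_iff₀ (by linarith)]
    have : 0 ≤ q^N := by positivity
    nlinarith
  have h2 : ∑ d ∈ Finset.range N, (if ((d+1 : ℕ):ℝ) ≤ w^2 then Real.exp (-w/24) else 0)
      ≤ w^2 * Real.exp (-w/24) := by
    rw [← Finset.sum_filter, Finset.sum_const, nsmul_eq_mul]
    apply mul_le_mul_of_nonneg_right _ (Real.exp_pos _).le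
    have hsub : (Finset.range N).filter (fun d => ((d+1 : ℕ):ℝ) ≤ w^2) ⊆ Finset.range ⌊w^2⌋₊ := by
      intro d hd
      rw [Finset.mem_filter] at hd
      rw [Finset.mem_range]
      have := Nat.le_floor hd.2
      omega
    have := Finset.card_le_card hsub
    rw [Finset.card_range] at this
    calc _ ≤ ((⌊w^2⌋₊ : ℕ) : ℝ) := by exact_mod_cast this
      _ ≤ w^2 := Nat.floor_le (by positivity)
  have h3 : ∑ d ∈ Finset.range N, Real.exp (2 - w/2) = N * Real.exp (2 - w/2) := by simp
  linarith

/-- Lower bound for the probability of a block event. -/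
lemma block_prob {Ω : Type*} [MeasurableSpace Ω] (P : Measure Ω) [IsProbabilityMeasure P]
    (B : ℝ → Ω → ℝ) (hmeas : ∀ t : ℝ, Measurable (B t))
    (hgauss : ∀ s t : ℝ, 0 ≤ s → s ≤ t →
      Measure.map (fun ω => B t ω - B s ω) P = gaussianReal 0 (Real.toNNReal (t - s)))
    (hpair : ∀ r s t : ℝ, 0 ≤ r → r ≤ s → s ≤ t →
      IndepFun (fun ω => B s ω - B r ω) (fun ω => B t ω - B s ω) P)
    (T : ℝ) (hT : 0 ≤ T) (V : ℝ) (hV : 0 < V) (w : ℝ) (hw : 2 ≤ w) (N : ℕ)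
    (hN : w^2 * Real.exp (-w/24) + N * Real.exp (2 - w/2) ≤ 1/4)
    (v : ℕ → ℝ) (hv : ∀ l, v l = V * Real.exp (192 / w * l)) :
    N * (Real.exp (-3/2) / √(2 * Real.pi) * Real.exp (-w/2) / √w) / 2 ≤
      P.real (⋃ l ∈ Finset.range N, {ω | √w * √(v l) < B (T + v l) ω - B T ω}) := by
  have hw0 : 0 < w := by linarith
  have hsw : 0 < √w := Real.sqrt_pos.2 hw0
  have hsww : √w * √w = w := Real.mul_self_sqrt hw0.le
  have hv0 : ∀ l, 0 < v l := fun l => by rw [hv]; positivity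
  set A : ℕ → Set Ω := fun l => {ω | √w * √(v l) < B (T + v l) ω - B T ω ∧
    B (T + v l) ω - B T ω ≤ (√w + 1/√w) * √(v l)} with hA
  have hmA : ∀ l, MeasurableSet (A l) := fun l =>
    (measurableSet_lt measurable_const ((hmeas _).sub (hmeas _))).inter
    (measurableSet_le ((hmeas _).sub (hmeas _)) measurable_const)
  have hb := bonferroni P N A hmA
    (Real.exp (-3/2) / √(2 * Real.pi) * Real.exp (-w/2) / √w) ?_
    (fun d => Real.exp (-4 * ((d+1 : ℕ):ℝ)) +
      (if ((d+1 : ℕ):ℝ) ≤ w^2 then Real.exp (-w/24) else 0) + Real.exp (2 - w/2)) ?_ ?_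
    (g_sum w hw N hN)
  · refine hb.trans (measureReal_mono ?_ (measure_ne_top _ _))
    apply iUnion₂_mono
    intro l _ ω hω
    exact hω.1
  · intro l _
    have := gauss_window P (fun ω => B (T + v l) ω - B T ω) ((hmeas _).sub (hmeas _)) (v l) (hv0 l)
      (by rw [hgauss T (T + v l) hT (by linarith [hv0 l])]; congr 2; ring) (√w)
      (by rw [Real.one_le_sqrt]; linarith)
    rw [Real.sq_sqrt hw0.le] at this
    exact this
  · intro d; split_ifs <;> positivity
  · intro l d
    obtain ⟨hu2, hg⟩ := g_bound w hw (d+1) (by omega) _ rfl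
    set u := Real.exp (192 / w * ((d+1 : ℕ):ℝ) / 2) - 1 with hu
    have hu0 : 0 < u := lt_of_lt_of_le (by positivity) hu2
    have hsq : √(v (l + (d+1))) = (1 + u) * √(v l) := by
      have : v (l + (d+1)) = (1+u)^2 * v l := by
        rw [hv, hv, hu, add_sub_cancel, ← Real.exp_nat_mul, mul_comm, mul_comm V, ← mul_assoc,
          ← Real.exp_add, mul_comm]
        rw [mul_comm V]; congr 2; push_cast; ring
      rw [this, Real.sqrt_mul (by positivity), Real.sqrt_sq (by linarith)]
    have hvv : v (l + (d+1)) = (1+u)^2 * v l := by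
      have := congrArg (fun x => x^2) hsq
      simpa [mul_pow, Real.sq_sqrt (hv0 _).le] using this
    have hle : v l ≤ v (l + (d+1)) := by
      rw [hvv]; exact le_mul_of_one_le_left (hv0 l).le (by nlinarith)
    set X := fun ω => B (T + v (l + (d+1))) ω - B (T + v l) ω with hX
    set ε := √w * √(v (l+(d+1))) - (√w + 1/√w) * √(v l) with hε
    have hε' : ε = √(v l) * √w * (u - 1/w) := by
      rw [hε, hsq]
      have : 1/√w = √w * (1/w) := by
        rw [mul_one_div, Real.sqrt_div_self']
      rw [this]; ring
    have h1w : 0 < 1/w := by positivity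
    have hε0 : 0 ≤ ε := by
      rw [hε']
      have : 2/w = 2 * (1/w) := by ring
      apply mul_nonneg (by positivity); linarith
    have hind := hpair T (T + v l) (T + v (l + (d+1))) hT (by linarith [hv0 l]) (by linarith)
    have hsub : A l ∩ A (l + (d+1)) ⊆ A l ∩ {ω | ε ≤ X ω} := by
      rintro ω ⟨h1, h2⟩
      refine ⟨h1, ?_⟩
      have := h1.2
      have := h2.1
      show ε ≤ X ω
      simp only [hε, hX]
      linarith
    have hprod : P.real (A l ∩ {ω | ε ≤ X ω}) = P.real (A l) * P.real {ω | ε ≤ X ω} := by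
      have := hind.measure_inter_preimage_eq_mul
        (Ioc (√w * √(v l)) ((√w + 1/√w) * √(v l))) (Ici ε) measurableSet_Ioc measurableSet_Ici
      simp only [measureReal_def]
      rw [← ENNReal.toReal_mul]
      exact congrArg ENNReal.toReal this
    have htail := gauss_tail P X ((hmeas _).sub (hmeas _)) (v (l+(d+1)) - v l).toNNReal
      (by rw [hX, hgauss _ _ (by linarith [hv0 l]) (by linarith)]; congr 2; ring) ε hε0
    calc P.real (A l ∩ A (l + (d+1))) ≤ P.real (A l ∩ {ω | ε ≤ X ω}) :=
          measureReal_mono hsub (measure_ne_top _ _)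
      _ = P.real (A l) * P.real {ω | ε ≤ X ω} := hprod
      _ ≤ _ := by
        apply mul_le_mul_of_nonneg_left _ measureReal_nonneg
        refine (htail.trans (le_of_eq ?_)).trans hg
        congr 1
        rw [Real.coe_toNNReal _ (by linarith), hvv, hε', mul_pow, mul_pow, Real.sq_sqrt (hv0 l).le,
          Real.sq_sqrt hw0.le]
        have := hv0 l
        have e : (1+u)^2 * v l - v l = v l * (u * (u+2)) := by ring
        rw [e]
        field_simp

def xx (i : ℕ) : ℝ := 2 ^ (i + 2)
def yy (i : ℕ) : ℝ := (i + 3) * Real.log 2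
def ww (i : ℕ) : ℝ := 2 * (yy i + 3 / 2 * Real.log (yy i) + 1)
def NN (i : ℕ) : ℕ := ⌊(xx i / 2 - 1) * ww i / 192⌋₊
def TT (i : ℕ) : ℝ := Real.exp (xx i)
def vv (i l : ℕ) : ℝ := Real.exp (3 / 2 * xx i) * Real.exp (192 / ww i * l)

lemma xx_ge (i : ℕ) : 4 ≤ xx i := by
  have : (1:ℝ) ≤ 2 ^ i := one_le_pow₀ (by norm_num)
  rw [xx, pow_add]; linarith

lemma xx_ge' (i : ℕ) : (i:ℝ) + 3 ≤ xx i := by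
  have h : i + 3 ≤ 2 ^ (i+2) := by
    induction i with
    | zero => norm_num
    | succ n ih => rw [show n + 1 + 2 = (n+2) + 1 by ring, pow_succ]; omega
  have : ((i + 3 : ℕ) : ℝ) ≤ ((2 ^ (i+2) : ℕ) : ℝ) := by exact_mod_cast h
  rw [xx]; push_cast at this; exact this

lemma yy_ge (i : ℕ) : 1 ≤ yy i := by
  have h := Real.log_two_gt_d9
  rw [yy]
  have : (0:ℝ) ≤ i := Nat.cast_nonneg _
  nlinarith

lemma yy_le (i : ℕ) : yy i ≤ i + 3 := by
  have h := Real.log_two_lt_d9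
  rw [yy]
  have : (0:ℝ) ≤ i := Nat.cast_nonneg _
  nlinarith

lemma exp_yy (i : ℕ) : Real.exp (yy i) = 2 * xx i := by
  have : yy i = ((i+3 : ℕ):ℝ) * Real.log 2 := by rw [yy]; push_cast; ring
  rw [this, Real.exp_nat_mul, Real.exp_log (by norm_num), xx]; ring

lemma ww_ge (i : ℕ) : 2 * yy i ≤ ww i := by
  have := Real.log_nonneg (yy_ge i)
  rw [ww]; linarith

lemma ww_ge2 (i : ℕ) : 2 ≤ ww i := by
  have := ww_ge i; have := yy_ge i; linarith

lemma ww_le (i : ℕ) : ww i ≤ 7 * yy i := by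
  have := Real.log_le_sub_one_of_pos (lt_of_lt_of_le one_pos (yy_ge i))
  have := yy_ge i
  rw [ww]; linarith

lemma exp_ww (i : ℕ) : Real.exp (-ww i / 2) =
    Real.exp (-1) / (2 * xx i) / (yy i * √(yy i)) := by
  have hy : 0 < yy i := lt_of_lt_of_le one_pos (yy_ge i)
  have : -ww i / 2 = -1 - yy i - (Real.log (yy i * √(yy i))) := by
    rw [Real.log_mul hy.ne' (Real.sqrt_pos.2 hy).ne', Real.log_sqrt hy.le, ww]; ring
  rw [this, Real.exp_sub, Real.exp_sub, exp_yy, Real.exp_log (by positivity)]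

lemma NN_le (i : ℕ) : (NN i : ℝ) ≤ (xx i / 2 - 1) * ww i / 192 := by
  apply Nat.floor_le
  have := xx_ge i; have := ww_ge2 i
  have : 0 ≤ xx i / 2 - 1 := by linarith
  positivity

lemma vv_le (i l : ℕ) (hl : l < NN i) : vv i l ≤ Real.exp (2 * xx i - 1) := by
  rw [vv, ← Real.exp_add]
  apply Real.exp_le_exp.2
  have h1 : (l:ℝ) ≤ (xx i / 2 - 1) * ww i / 192 :=
    le_trans (by exact_mod_cast hl.le) (NN_le i)
  have hw := ww_ge2 i
  have : 192 / ww i * l ≤ 192 / ww i * ((xx i / 2 - 1) * ww i / 192) := by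
    apply mul_le_mul_of_nonneg_left h1; positivity
  have e : 192 / ww i * ((xx i / 2 - 1) * ww i / 192) = xx i / 2 - 1 := by
    field_simp
  linarith

lemma vv_ge (i l : ℕ) : Real.exp (3 / 2 * xx i) ≤ vv i l := by
  have hw := ww_ge2 i
  rw [vv]
  apply le_mul_of_one_le_right (Real.exp_pos _).le
  apply Real.one_le_exp; positivity

lemma TT_le_vv (i l : ℕ) : TT i ≤ Real.exp (- xx i / 2) * vv i l := by
  calc TT i = Real.exp (- xx i / 2) * Real.exp (3 / 2 * xx i) := by
        rw [TT, ← Real.exp_add]; congr 1; ring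
    _ ≤ _ := mul_le_mul_of_nonneg_left (vv_ge i l) (Real.exp_pos _).le

lemma TT_add_vv_le (i l : ℕ) (hl : l < NN i) : TT i + vv i l ≤ Real.exp (2 * xx i) := by
  have h1 := TT_le_vv i l
  have h2 := vv_le i l hl
  have h3 : 0 < vv i l := lt_of_lt_of_le (Real.exp_pos _) (vv_ge i l)
  have h4 : Real.exp (- xx i / 2) ≤ 1 := by
    apply Real.exp_le_one_iff.2; have := xx_ge i; linarith
  have h5 : Real.exp (2 * xx i) = Real.exp 1 * Real.exp (2 * xx i - 1) := by
    rw [← Real.exp_add]; congr 1; ring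
  have h6 : 2 ≤ Real.exp 1 := by have := Real.add_one_le_exp (1:ℝ); linarith
  rw [h5]
  nlinarith [Real.exp_pos (2 * xx i - 1)]

lemma TT_succ (i : ℕ) : TT (i+1) = Real.exp (2 * xx i) := by
  rw [TT, xx, xx]; congr 1; ring

lemma ww_tendsto : Tendsto ww atTop atTop := by
  apply tendsto_atTop_mono ww_ge
  unfold yy
  apply Tendsto.const_mul_atTop (by norm_num)
  apply Tendsto.atTop_mul_const (Real.log_pos (by norm_num))
  exact tendsto_atTop_add_const_right _ _ tendsto_natCast_atTop_atTop

lemma cond_ev : ∀ᶠ i in atTop,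
    (ww i)^2 * Real.exp (-ww i/24) + NN i * Real.exp (2 - ww i/2) ≤ 1/4 := by
  have h1 : Tendsto (fun z : ℝ => z^2 * Real.exp (-z/24)) atTop (nhds 0) := by
    have h := (Real.tendsto_pow_mul_exp_neg_atTop_nhds_zero 2).comp
      (tendsto_id.atTop_div_const (show (0:ℝ) < 24 by norm_num))
    have h := h.const_mul (24^2 : ℝ)
    rw [mul_zero] at h
    refine h.congr (fun z => ?_)
    simp only [Function.comp, id]
    rw [neg_div]; ring
  have h2 := (h1.comp ww_tendsto).eventually (ge_mem_nhds (show (0:ℝ) < 1/8 by norm_num))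
  filter_upwards [h2] with i hi
  simp only [Function.comp] at hi
  have hx := xx_ge i
  have hy := yy_ge i
  have hw := ww_ge2 i
  have hw7 := ww_le i
  have : (NN i : ℝ) * Real.exp (2 - ww i/2) ≤ 1/8 := by
    have e : Real.exp (2 - ww i / 2) = Real.exp 2 * Real.exp (-ww i/2) := by
      rw [← Real.exp_add]; congr 1; ring
    have e1 : Real.exp 2 * Real.exp (-1) = Real.exp 1 := by
      rw [← Real.exp_add]; norm_num
    have hs1 : 1 ≤ √(yy i) := by rw [Real.one_le_sqrt]; exact hy
    have hN := NN_le i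
    have hN' : (NN i : ℝ) ≤ xx i * (7 * yy i) / 384 := by
      refine hN.trans ?_
      have : (xx i / 2 - 1) * ww i ≤ xx i / 2 * (7 * yy i) := by
        apply mul_le_mul (by linarith) hw7 (by linarith) (by linarith)
      linarith
    rw [e, exp_ww]
    have e3 : Real.exp 2 * (Real.exp (-1) / (2 * xx i) / (yy i * √(yy i))) =
        Real.exp 1 / (2 * xx i * (yy i * √(yy i))) := by
      rw [← e1]; field_simp
    rw [e3]
    calc (NN i : ℝ) * (Real.exp 1 / (2 * xx i * (yy i * √(yy i))))
        ≤ xx i * (7 * yy i) / 384 * (Real.exp 1 / (2 * xx i * (yy i * √(yy i)))) := by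
          apply mul_le_mul_of_nonneg_right hN'; positivity
      _ = 7 / 768 * Real.exp 1 / √(yy i) := by field_simp; norm_num
      _ ≤ 7 / 768 * Real.exp 1 / 1 := by
          apply div_le_div_of_nonneg_left _ one_pos hs1; positivity
      _ ≤ 1/8 := by have := Real.exp_one_lt_d9; linarith
  linarith

lemma prob_ev : ∃ c : ℝ, 0 < c ∧ ∀ᶠ i : ℕ in atTop, c / (i + 3) ≤
    NN i * (Real.exp (-3/2) / √(2 * Real.pi) * Real.exp (-ww i/2) / √(ww i)) / 2 := by
  set c0 := Real.exp (-3/2) / √(2 * Real.pi) with hc0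
  have hc0p : 0 < c0 := by positivity
  refine ⟨c0 * Real.exp (-1) / 6144, by positivity, ?_⟩
  filter_upwards [eventually_ge_atTop 800] with i hi
  have hx := xx_ge i
  have hx' := xx_ge' i
  have hi' : (800:ℝ) ≤ i := by exact_mod_cast hi
  have hy := yy_ge i
  have hw := ww_ge2 i
  have hwy := ww_ge i
  have hN : xx i * ww i / 1536 ≤ NN i := by
    have := Nat.lt_floor_add_one ((xx i / 2 - 1) * ww i / 192)
    rw [NN]
    nlinarith
  have hsw : √(yy i) ≤ √(ww i) := Real.sqrt_le_sqrt (by linarith)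
  have hsy : 0 < √(yy i) := Real.sqrt_pos.2 (by linarith)
  have hsw0 : 0 < √(ww i) := Real.sqrt_pos.2 (by linarith)
  have hy0 : 0 < yy i := by linarith
  calc c0 * Real.exp (-1) / 6144 / (i+3) ≤ c0 * Real.exp (-1) / 6144 / yy i :=
        div_le_div_of_nonneg_left (by positivity) (by linarith) (yy_le i)
    _ = c0 * Real.exp (-1) / 6144 / yy i * (√(yy i) / √(yy i)) := by
        rw [div_self hsy.ne', mul_one]
    _ ≤ c0 * Real.exp (-1) / 6144 / yy i * (√(ww i) / √(yy i)) := by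
        gcongr
    _ = xx i * (√(ww i) * √(ww i)) / 1536 * (c0 * (Real.exp (-1) / (2 * xx i) / (yy i * √(yy i))) / √(ww i)) / 2 := by
        field_simp; norm_num
    _ = xx i * ww i / 1536 * (c0 * Real.exp (-ww i/2) / √(ww i)) / 2 := by
        rw [exp_ww, Real.mul_self_sqrt (by linarith)]
    _ ≤ _ := by gcongr

set_option maxHeartbeats 1000000 in
lemma determ_ev : ∀ᶠ i : ℕ in atTop, ∀ l < NN i, ∀ β b : ℝ,
    -((i+3) * √(TT i)) ≤ b → √(ww i) * √(vv i l) < β - b →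
    2 * (TT i + vv i l) * (Real.log (Real.log (TT i + vv i l)) +
          (3 / 2) * Real.log (Real.log (Real.log (TT i + vv i l)))) < β ^ 2 := by
  have hlim : Tendsto (fun z : ℝ => z^2 * Real.exp (-z/4)) atTop (nhds 0) := by
    have h := (Real.tendsto_pow_mul_exp_neg_atTop_nhds_zero 2).comp
      (tendsto_id.atTop_div_const (show (0:ℝ) < 4 by norm_num))
    have h := h.const_mul (4^2 : ℝ)
    rw [mul_zero] at h
    refine h.congr (fun z => ?_)
    simp only [Function.comp, id]
    rw [neg_div]; ring
  have hm : Tendsto (fun i : ℕ => (i:ℝ) + 3) atTop atTop :=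
    tendsto_atTop_add_const_right _ _ tendsto_natCast_atTop_atTop
  have h2 := (hlim.comp hm).eventually (ge_mem_nhds (show (0:ℝ) < 1/100 by norm_num))
  filter_upwards [h2] with i hi l hl β b hb hβ
  simp only [Function.comp] at hi
  set m : ℝ := (i:ℝ) + 3 with hmdef
  have hm3 : 3 ≤ m := by rw [hmdef]; have : (0:ℝ) ≤ i := Nat.cast_nonneg _; linarith
  set x := xx i with hx
  set y := yy i with hy
  set w := ww i with hw
  set T := TT i with hT
  set v := vv i l with hv
  have hxm : m ≤ x := xx_ge' i
  have hym : y ≤ m := yy_le i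
  have hy1 : 1 ≤ y := yy_ge i
  have hw2 : 2 ≤ w := ww_ge2 i
  have hw7 : w ≤ 7 * y := ww_le i
  have hv0 : 0 < v := lt_of_lt_of_le (Real.exp_pos _) (vv_ge i l)
  have hTv : T ≤ Real.exp (-x/2) * v := TT_le_vv i l
  have hT0 : 0 < T := Real.exp_pos _
  -- the loglog bound
  set t := T + v with ht
  have htle : t ≤ Real.exp (2*x) := TT_add_vv_le i l hl
  have htge : Real.exp x ≤ t := by
    have : T = Real.exp x := rfl
    rw [ht, ← this]; linarith
  have ht0 : 0 < t := by linarith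
  have hL1 : x ≤ Real.log t := by rwa [Real.le_log_iff_exp_le ht0]
  have hL2 : Real.log t ≤ Real.exp y := by
    rw [exp_yy]; rwa [Real.log_le_iff_le_exp ht0]
  have hL0 : 0 < Real.log t := by linarith
  have hLL2 : Real.log (Real.log t) ≤ y := by rwa [Real.log_le_iff_le_exp hL0]
  have hLL0 : 0 < Real.log (Real.log t) := Real.log_pos (by linarith)
  have hLLL : Real.log (Real.log (Real.log t)) ≤ Real.log y := Real.log_le_log hLL0 hLL2
  set Q := Real.log (Real.log t) + (3 / 2) * Real.log (Real.log (Real.log t)) with hQ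
  have hQle : Q ≤ w / 2 - 1 := by
    have : w = 2 * (y + 3 / 2 * Real.log y + 1) := rfl
    rw [this]; linarith
  -- the main bound
  have hsT : √T ≤ Real.exp (-x/4) * √v := by
    rw [Real.sqrt_le_left (by positivity), mul_pow, Real.sq_sqrt hv0.le, ← Real.exp_nat_mul]
    refine hTv.trans (le_of_eq ?_)
    congr 2; push_cast; ring
  set δ := m * Real.exp (-x/4) with hδ
  have hexp : Real.exp (-x/4) ≤ Real.exp (-m/4) := Real.exp_le_exp.2 (by linarith)
  have he0 : 0 < Real.exp (-x/4) := Real.exp_pos _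
  have hmδ : m * δ ≤ 1/100 := by
    calc m * δ = m^2 * Real.exp (-x/4) := by rw [hδ]; ring
      _ ≤ m^2 * Real.exp (-m/4) := mul_le_mul_of_nonneg_left hexp (sq_nonneg m)
      _ ≤ 1/100 := hi
  have hδ0 : 0 < δ := by positivity
  have hsv : 0 < √v := Real.sqrt_pos.2 hv0
  have hβ1 : √v * (√w - δ) < β := by
    have : m * √T ≤ δ * √v := by
      rw [hδ, mul_assoc]; exact mul_le_mul_of_nonneg_left hsT (by linarith)
    linarith
  have hsw1 : 1 ≤ √w := by rw [Real.one_le_sqrt]; linarith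
  have hδs : δ ≤ 1/300 := by
    have : 3*δ ≤ m*δ := mul_le_mul_of_nonneg_right hm3 hδ0.le
    linarith
  have hδ1 : δ ≤ 1 := by linarith
  have hsww : √w * √w = w := Real.mul_self_sqrt (by linarith)
  have hsw7 : √w ≤ 7 * m := by nlinarith
  have hsq : v * (w - 2 * √w * δ) ≤ β^2 := by
    have h1 : (√v * (√w - δ))^2 ≤ β^2 :=
      pow_le_pow_left₀ (mul_nonneg hsv.le (by linarith)) hβ1.le 2
    rw [mul_pow, Real.sq_sqrt hv0.le] at h1
    refine le_trans (mul_le_mul_of_nonneg_left ?_ hv0.le) h1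
    have h6 : (√w - δ)^2 = w - 2 * √w * δ + δ^2 := by linear_combination hsww
    rw [h6]
    linarith [sq_nonneg δ]
  refine lt_of_lt_of_le ?_ hsq
  have h2 : √w * δ ≤ 7/100 := by
    have h7 : √w * δ ≤ 7 * m * δ := mul_le_mul_of_nonneg_right hsw7 hδ0.le
    linarith
  have he2 : Real.exp (-x/2) ≤ Real.exp (-x/4) := Real.exp_le_exp.2 (by linarith)
  have h3 : w * Real.exp (-x/2) ≤ 7/100 := by
    have : w * Real.exp (-x/2) ≤ (7 * m) * Real.exp (-x/4) :=
      mul_le_mul (by linarith) he2 (Real.exp_pos _).le (by linarith)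
    have h8 : (7 * m) * Real.exp (-x/4) = 7 * δ := by rw [hδ]; ring
    linarith
  have h4 : 2 * t * Q ≤ 2 * t * (w/2 - 1) := mul_le_mul_of_nonneg_left hQle (by linarith)
  have h5 : 2 * t * (w/2-1) ≤ v * ((1 + Real.exp (-x/2)) * (w - 2)) := by
    have : t * (w - 2) ≤ ((1 + Real.exp (-x/2)) * v) * (w-2) :=
      mul_le_mul_of_nonneg_right (by rw [ht]; linarith) (by linarith)
    linarith
  refine lt_of_le_of_lt (h4.trans h5) ?_
  apply mul_lt_mul_of_pos_left _ hv0
  have h9 : (1 + Real.exp (-x/2)) * (w - 2) = w - 2 + w * Real.exp (-x/2) - 2 * Real.exp (-x/2) := by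
    ring
  rw [h9]
  have := Real.exp_pos (-x/2)
  linarith

/-- Borel-Cantelli core: almost surely the inequality holds at arbitrarily large times. -/
lemma frequently_large {Ω : Type*} [MeasurableSpace Ω] (P : Measure Ω) [IsProbabilityMeasure P]
    (B : ℝ → Ω → ℝ)
    (hmeas : ∀ t : ℝ, Measurable (B t))
    (hB0 : ∀ᵐ ω ∂P, B 0 ω = 0)
    (hgauss : ∀ s t : ℝ, 0 ≤ s → s ≤ t →
      Measure.map (fun ω => B t ω - B s ω) P = gaussianReal 0 (Real.toNNReal (t - s)))
    (hindep : ∀ n : ℕ, ∀ ts : Fin (n + 1) → ℝ, Monotone ts → 0 ≤ ts 0 →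
      iIndepFun (m := fun _ : Fin n => (inferInstance : MeasurableSpace ℝ))
        (fun i ω => B (ts i.succ) ω - B (ts i.castSucc) ω) P) :
    ∀ᵐ ω ∂P, ∀ T : ℝ, ∃ t : ℝ, T ≤ t ∧
      2 * t * (Real.log (Real.log t) +
        (3 / 2) * Real.log (Real.log (Real.log t))) < (B t ω) ^ 2 := by
  have hpre := preBrownian P B hmeas hB0 hgauss hindep
  have hpair : ∀ r s t : ℝ, 0 ≤ r → r ≤ s → s ≤ t →
      IndepFun (fun ω => B s ω - B r ω) (fun ω => B t ω - B s ω) P := by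
    intro r s t hr hrs hst
    have h := hindep 2 ![r, s, t] (by
      intro i j hij
      fin_cases i <;> fin_cases j <;> simp at hij ⊢ <;> linarith) (by simpa using hr)
    have := h.indepFun (show (0 : Fin 2) ≠ 1 by decide)
    simpa using this
  have hT0 : ∀ i, 0 < TT i := fun i => Real.exp_pos _
  have hv0 : ∀ i l, 0 < vv i l := fun i l => lt_of_lt_of_le (Real.exp_pos _) (vv_ge i l)
  have hTm : Monotone TT := by
    refine monotone_nat_of_le_succ (fun i => ?_)
    rw [TT_succ, TT]
    exact Real.exp_le_exp.2 (by have := xx_ge i; linarith)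
  set E : ℕ → Set Ω := fun i => ⋃ l ∈ Finset.range (NN i),
    {ω | √(ww i) * √(vv i l) < B (TT i + vv i l) ω - B (TT i) ω} with hE
  have hEm : ∀ i, MeasurableSet (E i) := by
    intro i
    refine Finset.measurableSet_biUnion _ (fun l _ => ?_)
    exact measurableSet_lt measurable_const ((hmeas _).sub (hmeas _))
  have hEind : iIndepSet E P := by
    have hb := blocks_indep P _ hpre (fun i => (⟨TT i, (hT0 i).le⟩ : ℝ≥0))
      (fun i j hij => by exact_mod_cast hTm hij) NN
      (fun i l => (⟨TT i + vv i l, (add_pos (hT0 i) (hv0 i l)).le⟩ : ℝ≥0))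
      (fun i l => by
        have : TT i ≤ TT i + vv i l := by linarith [hv0 i l]
        exact_mod_cast this)
      (fun i l => by
        have : TT i + vv i l ≤ TT (i+1) := by rw [TT_succ]; exact TT_add_vv_le i l l.2
        exact_mod_cast this)
    rw [iIndepSet_iff_meas_biInter hEm]
    intro s
    have h := hb.measure_inter_preimage_eq_mul s
      (sets := fun i => ⋃ l : Fin (NN i), {f : Fin (NN i) → ℝ | √(ww i) * √(vv i l) < f l})
      (fun i _ => MeasurableSet.iUnion fun l =>
        measurableSet_lt measurable_const (measurable_pi_apply l))
    have hEeq : ∀ i, (fun ω (l : Fin (NN i)) => B (TT i + vv i l) ω - B (TT i) ω) ⁻¹'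
        (⋃ l : Fin (NN i), {f : Fin (NN i) → ℝ | √(ww i) * √(vv i l) < f l}) = E i := by
      intro i
      ext ω
      simp only [hE, mem_preimage, mem_iUnion, mem_ofPred_eq, Finset.mem_range, exists_prop]
      constructor
      · rintro ⟨l, hl⟩; exact ⟨l, l.2, hl⟩
      · rintro ⟨l, hl, h⟩; exact ⟨⟨l, hl⟩, h⟩
    have h' : P (⋂ i ∈ s, (fun ω (l : Fin (NN i)) => B (TT i + vv i l) ω - B (TT i) ω) ⁻¹'
        (⋃ l : Fin (NN i), {f : Fin (NN i) → ℝ | √(ww i) * √(vv i l) < f l})) =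
        ∏ i ∈ s, P ((fun ω (l : Fin (NN i)) => B (TT i + vv i l) ω - B (TT i) ω) ⁻¹'
        (⋃ l : Fin (NN i), {f : Fin (NN i) → ℝ | √(ww i) * √(vv i l) < f l})) := h
    simpa only [hEeq] using h'
  have hEsum : (∑' n, P (E n)) = ∞ := by
    by_contra hne
    have hs : Summable (fun n => P.real (E n)) := ENNReal.summable_toReal hne
    obtain ⟨c, hc, hcev⟩ := prob_ev
    have hs2 : Summable (fun n : ℕ => c / ((n:ℝ) + 3)) := by
      refine summable_of_isBigO_nat hs ?_
      refine Asymptotics.IsBigO.of_bound 1 ?_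
      filter_upwards [hcev, cond_ev] with i h1 h2
      have h3 := block_prob P B hmeas hgauss hpair (TT i) (hT0 i).le
        (Real.exp (3 / 2 * xx i)) (Real.exp_pos _) (ww i) (ww_ge2 i) (NN i) h2
        (vv i) (fun l => rfl)
      rw [one_mul, Real.norm_of_nonneg (by positivity), Real.norm_of_nonneg measureReal_nonneg]
      exact h1.trans h3
    have hs3 : Summable (fun n : ℕ => 1 / (((n + 3 : ℕ)) : ℝ)) := by
      have := hs2.mul_left c⁻¹
      refine this.congr (fun n => ?_)
      push_cast
      field_simp
    exact Real.not_summable_one_div_natCast ((summable_nat_add_iff 3).1 hs3)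
  have hE1 := measure_limsup_eq_one hEm hEind hEsum
  have hEfreq : ∀ᵐ ω ∂P, ∃ᶠ i in atTop, ω ∈ E i := by
    have : ∀ᵐ ω ∂P, ω ∈ limsup E atTop := by
      exact (mem_ae_iff_prob_eq_one (MeasurableSet.measurableSet_limsup hEm)).2 hE1
    filter_upwards [this] with ω hω
    rwa [mem_limsup_iff_frequently_mem] at hω
  have hF : ∀ᵐ ω ∂P, ∀ᶠ i : ℕ in atTop,
      ω ∉ {ω | ((i:ℝ) + 3) * √(TT i) ≤ -(B (TT i) ω - B 0 ω)} := by
    refine ae_eventually_notMem ?_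
    have hbd : ∀ i : ℕ, P.real {ω | ((i:ℝ) + 3) * √(TT i) ≤ -(B (TT i) ω - B 0 ω)} ≤
        Real.exp (-(i:ℝ)) := by
      intro i
      have hlaw : Measure.map (fun ω => -(B (TT i) ω - B 0 ω)) P =
          gaussianReal 0 (Real.toNNReal (TT i)) := by
        have h1 : (fun ω => -(B (TT i) ω - B 0 ω)) =
          (fun z : ℝ => -z) ∘ (fun ω => B (TT i) ω - B 0 ω) := rfl
        have h0 : Measurable (fun ω => B (TT i) ω - B 0 ω) := (hmeas _).sub (hmeas _)
        have h2 : Measurable (fun z : ℝ => -z) := measurable_neg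
        rw [h1, ← Measure.map_map h2 h0, hgauss 0 (TT i) le_rfl (hT0 i).le, gaussianReal_map_neg]
        simp
      refine (gauss_tail P _ ((hmeas _).sub (hmeas _)).neg _ hlaw _ (by positivity)).trans ?_
      rw [Real.coe_toNNReal _ (hT0 i).le, mul_pow, Real.sq_sqrt (hT0 i).le]
      apply Real.exp_le_exp.2
      have hne := (hT0 i).ne'
      have : -(((i:ℝ) + 3)^2 * TT i) / (2 * TT i) = -(((i:ℝ)+3)^2/2) := by field_simp
      rw [this]
      have : (0:ℝ) ≤ i := Nat.cast_nonneg _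
      nlinarith
    have hs : Summable (fun i : ℕ => P.real {ω | ((i:ℝ) + 3) * √(TT i) ≤ -(B (TT i) ω - B 0 ω)}) :=
      Summable.of_nonneg_of_le (fun _ => measureReal_nonneg) hbd Real.summable_exp_neg_nat
    have h2 : ∀ i : ℕ, P {ω | ((i:ℝ) + 3) * √(TT i) ≤ -(B (TT i) ω - B 0 ω)} =
        ENNReal.ofReal (P.real {ω | ((i:ℝ) + 3) * √(TT i) ≤ -(B (TT i) ω - B 0 ω)}) :=
      fun i => (ofReal_measureReal).symm
    rw [tsum_congr h2]
    exact hs.tsum_ofReal_ne_top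
  filter_upwards [hEfreq, hF, hB0] with ω h1 h2 h3 T
  have hTt : ∀ᶠ i : ℕ in atTop, T ≤ TT i := by
    have hm : Tendsto (fun i : ℕ => (i:ℝ)) atTop atTop := tendsto_natCast_atTop_atTop
    filter_upwards [hm.eventually_ge_atTop T] with i hi
    have := xx_ge' i
    have h4 := Real.add_one_le_exp (xx i)
    rw [TT]; linarith
  obtain ⟨i, hi, hi2, hi3, hi4⟩ := (h1.and_eventually (h2.and (hTt.and determ_ev))).exists
  simp only [hE, mem_iUnion, Finset.mem_range, mem_ofPred_eq, exists_prop] at hi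
  obtain ⟨l, hl, hlt⟩ := hi
  refine ⟨TT i + vv i l, by linarith [hv0 i l], hi4 l hl _ (B (TT i) ω) ?_ hlt⟩
  simp only [mem_ofPred_eq, not_le, h3] at hi2
  linarith

/-- Along arbitrarily large times the double exponential beats any power. -/
lemma superpoly (f : ℝ → ℝ) (hf : ∀ T : ℝ, ∃ t : ℝ, T ≤ t ∧
      2 * t * (Real.log (Real.log t) +
        (3 / 2) * Real.log (Real.log (Real.log t))) < (f t) ^ 2) (p T : ℝ) :
    ∃ t : ℝ, T ≤ t ∧ t ^ p ≤ Real.exp (Real.exp ((f t)^2 / (2 * t))) := by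
  obtain ⟨t, ht, h⟩ := hf (max T (Real.exp (Real.exp (max 1 p))))
  refine ⟨t, (le_max_left _ _).trans ht, ?_⟩
  have ht2 : Real.exp (Real.exp (max 1 p)) ≤ t := (le_max_right _ _).trans ht
  have ht0 : 0 < t := (Real.exp_pos _).trans_le ht2
  have hL : Real.exp (max 1 p) ≤ Real.log t := by rwa [Real.le_log_iff_exp_le ht0]
  have hL0 : 0 < Real.log t := (Real.exp_pos _).trans_le hL
  have hLL : max 1 p ≤ Real.log (Real.log t) := by rwa [Real.le_log_iff_exp_le hL0]
  have hLL1 : 1 ≤ Real.log (Real.log t) := (le_max_left _ _).trans hLL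
  have hLLp : p ≤ Real.log (Real.log t) := (le_max_right _ _).trans hLL
  have hLLL : 0 ≤ Real.log (Real.log (Real.log t)) := Real.log_nonneg hLL1
  have h2 : Real.log (Real.log t) + Real.log (Real.log (Real.log t)) ≤ (f t)^2 / (2*t) := by
    rw [le_div_iff₀ (by positivity)]
    have : 2 * t * (Real.log (Real.log t) + Real.log (Real.log (Real.log t))) ≤
      2 * t * (Real.log (Real.log t) + (3 / 2) * Real.log (Real.log (Real.log t))) :=
      mul_le_mul_of_nonneg_left (by linarith) (by positivity)
    linarith
  rw [Real.rpow_def_of_pos ht0]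
  apply Real.exp_le_exp.2
  calc Real.log t * p ≤ Real.log t * Real.log (Real.log t) :=
        mul_le_mul_of_nonneg_left hLLp hL0.le
    _ = Real.exp (Real.log (Real.log t) + Real.log (Real.log (Real.log t))) := by
        rw [Real.exp_add, Real.exp_log hL0, Real.exp_log (by linarith)]
    _ ≤ _ := Real.exp_le_exp.2 h2

lemma limsup_top (f : ℝ → ℝ) (hf : ∀ T : ℝ, ∃ t : ℝ, T ≤ t ∧
      2 * t * (Real.log (Real.log t) +
        (3 / 2) * Real.log (Real.log (Real.log t))) < (f t) ^ 2) (H γ : ℝ) :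
    limsup (fun t : ℝ =>
        ((t ^ (H - γ) * Real.exp (Real.exp ((f t) ^ 2 / (2 * t))) : ℝ) : EReal)) atTop = ⊤ := by
  rw [EReal.eq_top_iff_forall_lt]
  intro M
  refine lt_of_lt_of_le (EReal.coe_lt_coe_iff.2 (lt_add_one M)) ?_
  refine le_limsup_of_frequently_le ?_
  rw [frequently_atTop]
  intro T
  obtain ⟨t, ht, h⟩ := superpoly f hf (γ - H + 1) (max T (max 1 (M + 1)))
  have h1 : T ≤ t := (le_max_left _ _).trans ht
  have h2 : max 1 (M+1) ≤ t := (le_max_right _ _).trans ht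
  have h3 : 1 ≤ t := (le_max_left _ _).trans h2
  have h4 : M + 1 ≤ t := (le_max_right _ _).trans h2
  refine ⟨t, h1, EReal.coe_le_coe_iff.2 (h4.trans ?_)⟩
  have ht0 : 0 < t := by linarith
  calc t = t ^ (H - γ) * t ^ (γ - H + 1) := by
        rw [← Real.rpow_add ht0]
        ring_nf
        rw [Real.rpow_one]
    _ ≤ _ := mul_le_mul_of_nonneg_left h (Real.rpow_nonneg ht0.le _)

lemma iSup_top (f : ℝ → ℝ) (hf : ∀ T : ℝ, ∃ t : ℝ, T ≤ t ∧
      2 * t * (Real.log (Real.log t) +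
        (3 / 2) * Real.log (Real.log (Real.log t))) < (f t) ^ 2) (H : ℝ) (hH : 0 < H)
    (c : ℝ) (hc : 0 < c) (γ t : ℝ) (ht : 0 ≤ t) (K : ℝ) :
    (⨆ s : {s : ℝ // t ≤ s},
        (((s : ℝ) ^ H * Real.exp (Real.exp ((f (s : ℝ)) ^ 2 / (2 * (s : ℝ)))) - K
          - c * ((s : ℝ) - t) ^ γ : ℝ) : EReal)) = ⊤ := by
  rw [EReal.eq_top_iff_forall_lt]
  intro M
  obtain ⟨s, hs, h⟩ := superpoly f hf (|γ| + 1) (max (t + 1) (c + |M + 1 + K|))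
  have h1 : t + 1 ≤ s := (le_max_left _ _).trans hs
  have h2 : c + |M + 1 + K| ≤ s := (le_max_right _ _).trans hs
  refine lt_of_lt_of_le ?_ (le_iSup _ (⟨s, by linarith⟩ : {s : ℝ // t ≤ s}))
  rw [EReal.coe_lt_coe_iff]
  have hs1 : 1 ≤ s := by linarith
  have hs0 : 0 < s := by linarith
  have hg : (s - t) ^ γ ≤ s ^ |γ| :=
    (Real.rpow_le_rpow_of_exponent_le (by linarith) (le_abs_self γ)).trans
      (Real.rpow_le_rpow (by linarith) (by linarith) (abs_nonneg _))
  have hg1 : 1 ≤ s ^ |γ| := Real.one_le_rpow hs1 (abs_nonneg _)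
  have hH1 : 1 ≤ s ^ H := Real.one_le_rpow hs1 hH.le
  rw [Real.rpow_add hs0, Real.rpow_one] at h
  set X := Real.exp (Real.exp ((f s) ^ 2 / (2 * s))) with hX
  have hX0 : 0 ≤ X := (Real.exp_pos _).le
  have e1 : X ≤ s ^ H * X := le_mul_of_one_le_left hX0 hH1
  have e2 : c * (s - t)^γ ≤ c * s ^ |γ| := mul_le_mul_of_nonneg_left hg hc.le
  have e3 : |M + 1 + K| ≤ s ^ |γ| * (s - c) := by
    calc |M + 1 + K| ≤ s - c := by linarith
      _ ≤ s ^ |γ| * (s - c) :=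
        le_mul_of_one_le_left (by have := abs_nonneg (M+1+K); linarith) hg1
  have e4 := le_abs_self (M + 1 + K)
  have e5 : s ^ |γ| * (s - c) = s ^ |γ| * s - c * s ^ |γ| := by ring
  show M < s ^ H * X - K - c * (s - t) ^ γ
  linarith

end BSI

theorem brownian_storage_infinite
    {Ω : Type*} [MeasurableSpace Ω] (P : Measure Ω) [IsProbabilityMeasure P]
    (B : ℝ → Ω → ℝ)
    (hmeas : ∀ t : ℝ, Measurable (B t))
    (hB0 : ∀ᵐ ω ∂P, B 0 ω = 0)
    (hcont : ∀ᵐ ω ∂P, Continuous fun t : ℝ => B t ω)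
    (hgauss : ∀ s t : ℝ, 0 ≤ s → s ≤ t →
      Measure.map (fun ω => B t ω - B s ω) P = gaussianReal 0 (Real.toNNReal (t - s)))
    (hindep : ∀ n : ℕ, ∀ ts : Fin (n + 1) → ℝ, Monotone ts → 0 ≤ ts 0 →
      iIndepFun (m := fun _ : Fin n => (inferInstance : MeasurableSpace ℝ))
        (fun i ω => B (ts i.succ) ω - B (ts i.castSucc) ω) P) :
    P {ω | ∃ T : ℝ, ∀ t : ℝ, T ≤ t →
        (B t ω) ^ 2 ≤ 2 * t * (Real.log (Real.log t) +
          (3 / 2) * Real.log (Real.log (Real.log t)))} = 0 ∧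
    (∀ᵐ ω ∂P, ∀ T : ℝ, ∃ t : ℝ, T ≤ t ∧
      2 * t * (Real.log (Real.log t) +
        (3 / 2) * Real.log (Real.log (Real.log t))) < (B t ω) ^ 2) ∧
    (∀ H : ℝ, 0 < H → ∀ᵐ ω ∂P, ∀ γ : ℝ,
      limsup (fun t : ℝ =>
        ((t ^ (H - γ) * Real.exp (Real.exp ((B t ω) ^ 2 / (2 * t))) : ℝ) : EReal)) atTop = ⊤) ∧
    (∀ H : ℝ, 0 < H → ∀ c : ℝ, 0 < c → ∀ γ : ℝ, ∀ t : ℝ, 0 ≤ t → ∀ᵐ ω ∂P,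
      (⨆ s : {s : ℝ // t ≤ s},
        (((s : ℝ) ^ H * Real.exp (Real.exp ((B (s : ℝ) ω) ^ 2 / (2 * (s : ℝ)))) - t ^ H * Real.exp (Real.exp ((B t ω) ^ 2 / (2 * t))) - c * ((s : ℝ) - t) ^ γ : ℝ) : EReal)) = ⊤) := by
  have h2 := BSI.frequently_large P B hmeas hB0 hgauss hindep
  refine ⟨?_, h2, ?_, ?_⟩
  · refine measure_mono_null ?_ (ae_iff.1 h2)
    rintro ω ⟨T, hT⟩
    simp only [mem_ofPred_eq, not_forall]
    refine ⟨T, ?_⟩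
    rintro ⟨t, ht, hlt⟩
    exact absurd hlt (not_lt.2 (hT t ht))
  · intro H hH
    filter_upwards [h2] with ω hω γ
    exact BSI.limsup_top (fun t => B t ω) hω H γ
  · intro H hH c hc γ t ht
    filter_upwards [h2] with ω hω
    exact BSI.iSup_top (fun t => B t ω) hω H hH c hc γ t ht _
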